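/- Let Λ ⊂ ℝ^d be a full lattice with fundamental domain D and dual lattice H, let Ω k-tile ℝ^d by Λ, and let a₁,…,a_k ∈ ℝ^d. For finitely supported coefficients {c_{j,h}}, define P(ω) = ∑_{j=1}^k ∑_{h∈H} c_{j,h} e^{2πi(a_j+h)·ω} and m_j(ω) = ∑_{h∈H} c_{j,h} e^{2πi h·ω}. Then ‖P‖²_{L²(Ω)} = ∫_D ‖T_ω m(ω)‖²_{ℂ^k} dω, where m(ω) = (m₁(ω),…,m_k(ω)) and T_ω = (e^{2πi a_j·(ω+λ_l(ω))})_{1≤l,j≤k} with Λ_ω = {λ₁(ω),…,λ_k(ω)}. Moreover ∫_D ‖m(ω)‖²_{ℂ^k} dω = |D| ∑_{j,h} |c_{j,h}|². -/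

import Mathlib

open scoped Classical

open MeasureTheory Matrix

noncomputable section

/-- The lattice vector `M z` for an integer vector `z`. -/
def latVec {d : ℕ} (M : Matrix (Fin d) (Fin d) ℝ) (z : Fin d → ℤ) : Fin d → ℝ :=
  M.mulVec (fun i => (z i : ℝ))

/-- The dual lattice vector `(Mᵀ)⁻¹ z`: a general point of the dual lattice `H` of `M ℤ^d`. -/
def dualVec {d : ℕ} (M : Matrix (Fin d) (Fin d) ℝ) (z : Fin d → ℤ) : Fin d → ℝ :=
  (M.transpose)⁻¹.mulVec (fun i => (z i : ℝ))

/-- The fundamental domain `M [0,1)^d` of the full lattice `M ℤ^d`. -/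
def Dom {d : ℕ} (M : Matrix (Fin d) (Fin d) ℝ) : Set (Fin d → ℝ) :=
  (fun t => M.mulVec t) '' (Set.univ.pi fun _ => Set.Ico (0 : ℝ) 1)

/-- The exponential `e_a(ω) = e^{2πi a·ω}`. -/
def expv {d : ℕ} (a ω : Fin d → ℝ) : ℂ :=
  Complex.exp (2 * Real.pi * Complex.I * (∑ i, a i * ω i))

/-- The columns of an invertible matrix `M`, as a basis of `ℝ^d`. -/
def latBasis {d : ℕ} (M : Matrix (Fin d) (Fin d) ℝ) (hM : IsUnit M.det) :
    Module.Basis (Fin d) ℝ (Fin d → ℝ) :=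
  .ofEquivFun (M.toLinearEquiv' (M.invertibleOfIsUnitDet hM)).symm

lemma latBasis_equivFun_symm_apply {d : ℕ} (M : Matrix (Fin d) (Fin d) ℝ) (hM : IsUnit M.det)
    (t : Fin d → ℝ) : (latBasis M hM).equivFun.symm t = M.mulVec t := by
  simp only [latBasis, Module.Basis.equivFun_ofEquivFun, LinearEquiv.symm_symm]
  rfl

lemma Dom_eq_fundamentalDomain {d : ℕ} (M : Matrix (Fin d) (Fin d) ℝ) (hM : IsUnit M.det) :
    Dom M = ZSpan.fundamentalDomain (latBasis M hM) := by
  ext x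
  simp only [Dom, ← latBasis_equivFun_symm_apply M hM, Set.mem_image, Set.mem_univ_pi,
    ZSpan.mem_fundamentalDomain]
  constructor
  · rintro ⟨t, ht, rfl⟩ i
    rw [← Module.Basis.equivFun_apply, LinearEquiv.apply_symm_apply]
    exact ht i
  · intro h
    exact ⟨(latBasis M hM).equivFun x, h, LinearEquiv.symm_apply_apply _ _⟩

/-- Integer vectors parametrize the lattice spanned by the columns of `M`. -/
def latEquiv {d : ℕ} (M : Matrix (Fin d) (Fin d) ℝ) (hM : IsUnit M.det) :
    (Fin d → ℤ) ≃ (Submodule.span ℤ (Set.range (latBasis M hM))).toAddSubgroup :=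
  ((latBasis M hM).restrictScalars ℤ).equivFun.symm.toEquiv

lemma coe_latEquiv {d : ℕ} (M : Matrix (Fin d) (Fin d) ℝ) (hM : IsUnit M.det) (z : Fin d → ℤ) :
    (latEquiv M hM z : Fin d → ℝ) = latVec M z := by
  rw [latVec, ← latBasis_equivFun_symm_apply M hM]
  change ((((latBasis M hM).restrictScalars ℤ).equivFun.symm z :
    Submodule.span ℤ (Set.range (latBasis M hM))) : Fin d → ℝ) = _
  simp [Module.Basis.equivFun_symm_apply, Int.cast_smul_eq_zsmul]

/-- Unfolding an integral over `ℝ^d` along the lattice `M ℤ^d`. -/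
lemma integral_eq_integral_Dom_tsum {d : ℕ} (M : Matrix (Fin d) (Fin d) ℝ) (hM : IsUnit M.det)
    (f : (Fin d → ℝ) → ℝ) (hf : Integrable f) :
    ∫ ω, f ω = ∫ ω in Dom M, ∑' z : Fin d → ℤ, f (ω + latVec M z) := by
  have := (latEquiv M hM).symm.countable_iff.mpr inferInstance
  have hD := ZSpan.isAddFundamentalDomain' (latBasis M hM) volume
  rw [← Dom_eq_fundamentalDomain M hM] at hD
  have hshift (z : Fin d → ℤ) (ω : Fin d → ℝ) : latEquiv M hM z +ᵥ ω = ω + latVec M z := by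
    rw [add_comm, ← coe_latEquiv M hM]; rfl
  rw [integral_tsum]
  · rw [hD.integral_eq_tsum'' f hf, ← (latEquiv M hM).tsum_eq]
    simp_rw [hshift]
  · intro z
    exact (hf.comp_add_right (latVec M z)).aestronglyMeasurable.restrict
  · have h := hD.lintegral_eq_tsum'' (fun ω => ‖f ω‖ₑ)
    rw [← (latEquiv M hM).tsum_eq] at h
    simp_rw [hshift] at h
    rw [← h]
    exact hf.2.ne

lemma expv_add_left {d : ℕ} (a b ω : Fin d → ℝ) : expv (a + b) ω = expv a ω * expv b ω := by
  simp only [expv, ← Complex.exp_add, Pi.add_apply, ← mul_add, add_mul, Finset.sum_add_distrib,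
    Complex.ofReal_add]

lemma expv_add_right {d : ℕ} (a ω η : Fin d → ℝ) : expv a (ω + η) = expv a ω * expv a η := by
  simp only [expv, ← Complex.exp_add, Pi.add_apply, mul_add, Finset.sum_add_distrib,
    Complex.ofReal_add]

lemma continuous_expv {d : ℕ} (a : Fin d → ℝ) : Continuous (expv a) := by
  unfold expv
  fun_prop

lemma conj_expv {d : ℕ} (a ω : Fin d → ℝ) : starRingEnd ℂ (expv a ω) = expv (-a) ω := by
  simp [expv, ← Complex.exp_conj, Complex.conj_ofNat]

lemma norm_expv {d : ℕ} (a ω : Fin d → ℝ) : ‖expv a ω‖ = 1 := by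
  have : (2 * Real.pi * Complex.I * (∑ i, a i * ω i) : ℂ)
      = (2 * Real.pi * ∑ i, a i * ω i : ℝ) * Complex.I := by
    push_cast; ring
  rw [expv, this, Complex.norm_exp_ofReal_mul_I]

lemma dualVec_sub {d : ℕ} (M : Matrix (Fin d) (Fin d) ℝ) (z w : Fin d → ℤ) :
    dualVec M (z - w) = dualVec M z - dualVec M w := by
  simp only [dualVec, ← Matrix.mulVec_sub]
  congr 1
  ext i
  simp

lemma dualVec_dotProduct_mulVec {d : ℕ} (M : Matrix (Fin d) (Fin d) ℝ) (hM : IsUnit M.det)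
    (z : Fin d → ℤ) (t : Fin d → ℝ) :
    ∑ i, dualVec M z i * M.mulVec t i = ∑ i, (z i : ℝ) * t i := by
  change dualVec M z ⬝ᵥ M.mulVec t = (fun i => (z i : ℝ)) ⬝ᵥ t
  rw [dualVec, Matrix.dotProduct_mulVec, ← Matrix.mulVec_transpose, Matrix.mulVec_mulVec,
    Matrix.mul_nonsing_inv _ (by rwa [Matrix.det_transpose]), Matrix.one_mulVec]

lemma expv_dualVec_mulVec {d : ℕ} (M : Matrix (Fin d) (Fin d) ℝ) (hM : IsUnit M.det)
    (z : Fin d → ℤ) (t : Fin d → ℝ) :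
    expv (dualVec M z) (M.mulVec t) = ∏ i, Complex.exp (2 * Real.pi * Complex.I * z i * t i) := by
  rw [expv, dualVec_dotProduct_mulVec M hM, Complex.ofReal_sum, Finset.mul_sum, Complex.exp_sum]
  simp [mul_assoc]

lemma expv_dualVec_latVec {d : ℕ} (M : Matrix (Fin d) (Fin d) ℝ) (hM : IsUnit M.det)
    (z w : Fin d → ℤ) : expv (dualVec M z) (latVec M w) = 1 := by
  rw [latVec, expv_dualVec_mulVec M hM]
  refine Finset.prod_eq_one fun i _ => ?_
  rw [Complex.exp_eq_one_iff]
  exact ⟨z i * w i, by push_cast; ring⟩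

lemma integral_Ico_exp_int {n : ℤ} (hn : n ≠ 0) :
    ∫ t in Set.Ico (0 : ℝ) 1, Complex.exp (2 * Real.pi * Complex.I * n * t) = 0 := by
  have hc : (2 * Real.pi * Complex.I * n : ℂ) ≠ 0 :=
    mul_ne_zero Complex.two_pi_I_ne_zero (Int.cast_ne_zero.mpr hn)
  rw [integral_Ico_eq_integral_Ioc, ← intervalIntegral.integral_of_le zero_le_one,
    integral_exp_mul_complex hc]
  have h1 : Complex.exp (2 * Real.pi * Complex.I * n * (1 : ℝ)) = 1 :=
    Complex.exp_eq_one_iff.mpr ⟨n, by push_cast; ring⟩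
  rw [h1]
  simp

/-- Change of variables from `Dom M` to the unit cube. -/
lemma integral_Dom {d : ℕ} (M : Matrix (Fin d) (Fin d) ℝ) (hM : IsUnit M.det)
    (g : (Fin d → ℝ) → ℂ) :
    ∫ ω in Dom M, g ω =
      |M.det| • ∫ t in Set.univ.pi fun _ : Fin d => Set.Ico (0 : ℝ) 1, g (M.mulVec t) := by
  have hinj : Function.Injective M.mulVec :=
    Matrix.mulVec_injective_of_isUnit ((Matrix.isUnit_iff_isUnit_det M).mpr hM)
  have h := integral_image_eq_integral_abs_det_fderiv_smul volume
    (s := Set.univ.pi fun _ : Fin d => Set.Ico (0 : ℝ) 1)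
    (MeasurableSet.univ_pi fun _ => measurableSet_Ico)
    (fun x _ => (LinearMap.toContinuousLinearMap M.toLin').hasFDerivAt.hasFDerivWithinAt)
    hinj.injOn g
  rw [← integral_smul]
  simp only [ContinuousLinearMap.det, LinearMap.coe_toContinuousLinearMap, LinearMap.det_toLin'] at h
  exact h

lemma integral_Dom_expv_dualVec {d : ℕ} (M : Matrix (Fin d) (Fin d) ℝ) (hM : IsUnit M.det)
    {z : Fin d → ℤ} (hz : z ≠ 0) : ∫ ω in Dom M, expv (dualVec M z) ω = 0 := by
  obtain ⟨i, hi⟩ := Function.ne_iff.mp hz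
  rw [integral_Dom M hM]
  simp_rw [expv_dualVec_mulVec M hM]
  rw [volume_pi, Measure.restrict_pi_pi, integral_fintype_prod_eq_prod
    (fun i (t : ℝ) => Complex.exp (2 * Real.pi * Complex.I * z i * t)),
    Finset.prod_eq_zero (Finset.mem_univ i) (integral_Ico_exp_int hi), smul_zero]

/-- Orthogonality of the dual-lattice exponentials on `Dom M`. -/
lemma integral_Dom_expv_mul_conj {d : ℕ} (M : Matrix (Fin d) (Fin d) ℝ) (hM : IsUnit M.det)
    (z w : Fin d → ℤ) :
    ∫ ω in Dom M, expv (dualVec M z) ω * starRingEnd ℂ (expv (dualVec M w) ω) =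
      if z = w then ((volume (Dom M)).toReal : ℂ) else 0 := by
  simp_rw [conj_expv, ← expv_add_left, ← sub_eq_add_neg, ← dualVec_sub]
  split_ifs with h
  · subst h
    simp [expv, dualVec, Measure.real, ← Pi.zero_def]
  · exact integral_Dom_expv_dualVec M hM (sub_ne_zero.mpr h)

lemma integrableOn_Dom_of_continuous {d : ℕ} {E : Type*} [NormedAddCommGroup E]
    (M : Matrix (Fin d) (Fin d) ℝ) (hM : IsUnit M.det) {g : (Fin d → ℝ) → E}
    (hg : Continuous g) : IntegrableOn g (Dom M) := by
  have hb : Bornology.IsBounded (Dom M) :=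
    Dom_eq_fundamentalDomain M hM ▸ ZSpan.fundamentalDomain_isBounded _
  exact (hg.continuousOn.integrableOn_compact hb.isCompact_closure).mono_set subset_closure

/-- Parseval's identity on `Dom M` for finite sums of dual-lattice exponentials. -/
lemma integral_Dom_norm_sq_sum {d : ℕ} (M : Matrix (Fin d) (Fin d) ℝ) (hM : IsUnit M.det)
    (c : (Fin d → ℤ) →₀ ℂ) :
    ∫ ω in Dom M, ‖∑ z ∈ c.support, c z * expv (dualVec M z) ω‖ ^ 2 =
      (volume (Dom M)).toReal * ∑ z ∈ c.support, ‖c z‖ ^ 2 := by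
  rw [← Complex.ofReal_inj, ← integral_complex_ofReal]
  have hexp (ω : Fin d → ℝ) : ((‖∑ z ∈ c.support, c z * expv (dualVec M z) ω‖ ^ 2 : ℝ) : ℂ) =
      ∑ z ∈ c.support, ∑ w ∈ c.support, c z * starRingEnd ℂ (c w) *
        (expv (dualVec M z) ω * starRingEnd ℂ (expv (dualVec M w) ω)) := by
    rw [Complex.ofReal_pow, ← Complex.mul_conj', map_sum, Finset.sum_mul_sum]
    refine Finset.sum_congr rfl fun z _ => Finset.sum_congr rfl fun w _ => ?_
    rw [map_mul]
    ring
  have hint (z w : Fin d → ℤ) : IntegrableOn (fun ω => c z * starRingEnd ℂ (c w) *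
      (expv (dualVec M z) ω * starRingEnd ℂ (expv (dualVec M w) ω))) (Dom M) :=
    integrableOn_Dom_of_continuous M hM (continuous_const.mul
      ((continuous_expv _).mul (Complex.continuous_conj.comp (continuous_expv _))))
  simp_rw [hexp]
  rw [integral_finsetSum _ fun z _ => integrable_finsetSum _ fun w _ => hint z w]
  push_cast
  rw [Finset.mul_sum]
  refine Finset.sum_congr rfl fun z hz => ?_
  rw [integral_finsetSum _ fun w _ => hint z w]
  simp_rw [integral_const_mul, integral_Dom_expv_mul_conj M hM, mul_ite, mul_zero]
  rw [Finset.sum_ite_eq, if_pos hz, Complex.mul_conj', mul_comm]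

/-- For a `k`-tile `Ω` and finitely supported coefficients `c_{j,h}`, letting
`P = ∑_{j,h} c_{j,h} e_{a_j+h}` and `m_j = ∑_h c_{j,h} e_h`, one has
`‖P‖²_{L²(Ω)} = ∫_D ‖T_ω m(ω)‖²_{ℂ^k} dω` (where `‖T_ω m(ω)‖²` is written as the sum over the
fiber `Λ_ω` of `‖∑_j m_j(ω) e^{2πi a_j·(ω+λ)}‖²`), and
`∫_D ‖m(ω)‖² dω = |D| ∑_{j,h} |c_{j,h}|²`. -/
theorem norm_P_eq_fiber_integral (d k : ℕ)
    (M : Matrix (Fin d) (Fin d) ℝ) (hM : IsUnit M.det)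
    (Ω : Set (Fin d → ℝ)) (hmeas : MeasurableSet Ω) (hfin : volume Ω < ⊤)
    (htile : ∀ᵐ ω ∂(volume.restrict (Dom M)),
      {z : Fin d → ℤ | ω + latVec M z ∈ Ω}.encard = (k : ℕ∞))
    (a : Fin k → (Fin d → ℝ)) (c : Fin k → ((Fin d → ℤ) →₀ ℂ))
    (P : (Fin d → ℝ) → ℂ)
    (hP : P = fun ω => ∑ j : Fin k, ∑ z ∈ (c j).support,
      c j z * expv (a j + dualVec M z) ω)
    (m : Fin k → (Fin d → ℝ) → ℂ)
    (hm : m = fun j ω => ∑ z ∈ (c j).support, c j z * expv (dualVec M z) ω) :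
    (∫ ω in Ω, ‖P ω‖ ^ 2) =
      (∫ ω in Dom M, ∑' z : Fin d → ℤ,
        (if ω + latVec M z ∈ Ω then
          ‖∑ j : Fin k, m j ω * expv (a j) (ω + latVec M z)‖ ^ 2 else 0)) ∧
    (∫ ω in Dom M, ∑ j : Fin k, ‖m j ω‖ ^ 2) =
      (volume (Dom M)).toReal * ∑ j : Fin k, ∑ z ∈ (c j).support, ‖c j z‖ ^ 2 := by
  have hmc (j : Fin k) : Continuous (m j) := by
    rw [hm]
    exact continuous_finsetSum _ fun z _ => continuous_const.mul (continuous_expv _)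
  constructor
  · have hPm (ω : Fin d → ℝ) : P ω = ∑ j, m j ω * expv (a j) ω := by
      simp only [hP, hm, Finset.sum_mul, expv_add_left]
      exact Finset.sum_congr rfl fun j _ => Finset.sum_congr rfl fun z _ => by ring
    have hPc : Continuous P := by
      rw [funext hPm]
      exact continuous_finsetSum _ fun j _ => (hmc j).mul (continuous_expv _)
    have hmper (j : Fin k) (ω : Fin d → ℝ) (w : Fin d → ℤ) : m j (ω + latVec M w) = m j ω := by
      simp only [hm, expv_add_right, expv_dualVec_latVec M hM, mul_one]
    have hPbound (ω : Fin d → ℝ) : ‖P ω‖ ≤ ∑ j, ∑ z ∈ (c j).support, ‖c j z‖ := by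
      rw [hP]
      refine (norm_sum_le _ _).trans (Finset.sum_le_sum fun j _ => ?_)
      refine (norm_sum_le _ _).trans (Finset.sum_le_sum fun z _ => ?_)
      rw [norm_mul, norm_expv, mul_one]
    have hPint : IntegrableOn (fun ω => ‖P ω‖ ^ 2) Ω := by
      refine Measure.integrableOn_of_bounded hfin.ne (hPc.norm.pow 2).aestronglyMeasurable
        (M := (∑ j, ∑ z ∈ (c j).support, ‖c j z‖) ^ 2) (Filter.Eventually.of_forall fun ω => ?_)
      rw [norm_pow, norm_norm]
      exact pow_le_pow_left₀ (norm_nonneg _) (hPbound ω) 2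
    rw [← integral_indicator hmeas,
      integral_eq_integral_Dom_tsum M hM _ (hPint.integrable_indicator hmeas)]
    simp only [Set.indicator_apply, hPm, hmper]
  · have hint (j : Fin k) : IntegrableOn (fun ω => ‖m j ω‖ ^ 2) (Dom M) :=
      integrableOn_Dom_of_continuous M hM ((hmc j).norm.pow 2)
    rw [integral_finsetSum _ fun j _ => hint j, Finset.mul_sum]
    refine Finset.sum_congr rfl fun j _ => ?_
    rw [hm]
    exact integral_Dom_norm_sq_sum M hM (c j)
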